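/- For every ultrafilter U on a countably infinite set X, the following are equivalent: (1) U·U ≡_T U; (2) ∏_{n<ω} U ≡_T U; (3) there is an ideal I ⊆ U* on X such that U has the I-pseudo-intersection property and ∏_{n<ω} I ≤_T U. -/

import Mathlib

open Set

/-- A subset `S` is bounded with respect to the relation `r`. -/
def RelBounded {α : Type*} (r : α → α → Prop) (S : Set α) : Prop :=
  ∃ b, ∀ a ∈ S, r a b

/-- Tukey reducibility between two ordered sets: there is a map sending every
unbounded set to an unbounded set. -/
def TukeyLE {α β : Type*} (ra : α → α → Prop) (rb : β → β → Prop) : Prop :=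
  ∃ f : α → β, ∀ S : Set α, ¬ RelBounded ra S → ¬ RelBounded rb (f '' S)

/-- Tukey equivalence. -/
def TukeyEquiv {α β : Type*} (ra : α → α → Prop) (rb : β → β → Prop) : Prop :=
  TukeyLE ra rb ∧ TukeyLE rb ra

/-- `S` is cofinal with respect to the relation `r`. -/
def IsCofinalIn {α : Type*} (r : α → α → Prop) (S : Set α) : Prop :=
  ∀ a, ∃ b ∈ S, r a b

/-- The poset `(U, ⊇)` associated to a filter `U`: `A ≤ B` iff `A ⊇ B`. -/
def filtRel {X : Type*} (U : Filter X) :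
    {A : Set X // A ∈ U} → {A : Set X // A ∈ U} → Prop :=
  fun A B => B.1 ⊆ A.1

/-- The poset `(I, ⊆)` associated to a family of sets `I`. -/
def subRel {X : Type*} (I : Set (Set X)) :
    {A : Set X // A ∈ I} → {A : Set X // A ∈ I} → Prop :=
  fun A B => A.1 ⊆ B.1

/-- The Fubini product of filters: `A ∈ U·V` iff `{x | (A)_x ∈ V} ∈ U`,
where `(A)_x = {y | (x, y) ∈ A}`. -/
def fubini {X Y : Type*} (U : Filter X) (V : Filter Y) : Filter (X × Y) :=
  U.bind fun x => V.map (Prod.mk x)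

/-- The ω-fold power of an ordered set, with the everywhere (pointwise)
domination order. -/
def seqRel {α : Type*} (r : α → α → Prop) : (ℕ → α) → (ℕ → α) → Prop :=
  fun f g => ∀ n, r (f n) (g n)

/-- The product order on a Cartesian product of two ordered sets. -/
def prodRel {α β : Type*} (ra : α → α → Prop) (rb : β → β → Prop) :
    α × β → α × β → Prop :=
  fun p q => ra p.1 q.1 ∧ rb p.2 q.2

/-- The everywhere domination order on `ω^ω`. -/
def domRel : (ℕ → ℕ) → (ℕ → ℕ) → Prop := fun f g => ∀ n, f n ≤ g n

/-- An ideal on `X`: a family of subsets containing `∅`, closed under subsets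
and finite unions. -/
def IsIdeal {X : Type*} (I : Set (Set X)) : Prop :=
  ∅ ∈ I ∧ (∀ A ∈ I, ∀ B ⊆ A, B ∈ I) ∧ (∀ A ∈ I, ∀ B ∈ I, A ∪ B ∈ I)

/-- `U` has the `I`-pseudo-intersection property: every ω-sequence of members of `U`
has a pseudo-intersection modulo `I` in `U`. -/
def HasPIP {X : Type*} (U : Filter X) (I : Set (Set X)) : Prop :=
  ∀ A : ℕ → Set X, (∀ n, A n ∈ U) → ∃ B ∈ U, ∀ n, B \ A n ∈ I

/-- A p-point: a nonprincipal ultrafilter on `ω` which has the fin-pseudo-intersection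
property. -/
def IsPPoint (U : Ultrafilter ℕ) : Prop :=
  (∀ a : ℕ, (U : Filter ℕ) ≠ pure a) ∧
  ∀ A : ℕ → Set ℕ, (∀ n, A n ∈ U) → ∃ B ∈ U, ∀ n, (B \ A n).Finite

/-- A rapid ultrafilter: a nonprincipal ultrafilter `U` on `ω` such that for every
increasing `f : ω → ω` there is `X ∈ U` with `|X ∩ f(n)| ≤ n` for all `n`. -/
def IsRapid (U : Ultrafilter ℕ) : Prop :=
  (∀ a : ℕ, (U : Filter ℕ) ≠ pure a) ∧
  ∀ f : ℕ → ℕ, StrictMono f → ∃ X ∈ U, ∀ n, (X ∩ Set.Iio (f n)).ncard ≤ n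

/-- The ideal `fin ⊗ fin` on `ω × ω`: all sets with only finitely many infinite
vertical sections. -/
def finOtimesFin : Set (Set (ℕ × ℕ)) :=
  {A | {n : ℕ | {m : ℕ | (n, m) ∈ A}.Infinite}.Finite}

theorem TukeyLE.of_bounded {α β : Type*} {ra : α → α → Prop} {rb : β → β → Prop} (f : α → β)
    (h : ∀ (S : Set α) (b : β), (∀ a ∈ S, rb (f a) b) → ∃ c, ∀ a ∈ S, ra a c) :
    TukeyLE ra rb := by
  refine ⟨f, fun S hS ⟨b, hb⟩ => hS ?_⟩
  exact h S b fun a ha => hb _ (mem_image_of_mem f ha)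

theorem TukeyLE.exists_bounded {α β : Type*} {ra : α → α → Prop} {rb : β → β → Prop}
    (h : TukeyLE ra rb) :
    ∃ f : α → β, ∀ (S : Set α) (b : β), (∀ a ∈ S, rb (f a) b) → ∃ c, ∀ a ∈ S, ra a c := by
  obtain ⟨f, hf⟩ := h
  refine ⟨f, fun S b hb => ?_⟩
  by_contra hS
  refine hf S hS ⟨b, ?_⟩
  rintro _ ⟨a, ha, rfl⟩
  exact hb a ha

theorem TukeyLE.trans {α β γ : Type*} {ra : α → α → Prop} {rb : β → β → Prop}
    {rc : γ → γ → Prop} (hab : TukeyLE ra rb) (hbc : TukeyLE rb rc) : TukeyLE ra rc := by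
  obtain ⟨f, hf⟩ := hab
  obtain ⟨g, hg⟩ := hbc
  refine ⟨g ∘ f, fun S hS => ?_⟩
  rw [image_comp]
  exact hg _ (hf S hS)

theorem mem_fubini {X Y : Type*} {U : Filter X} {V : Filter Y} {A : Set (X × Y)} :
    A ∈ fubini U V ↔ {x | {y | (x, y) ∈ A} ∈ V} ∈ U :=
  Iff.rfl

theorem filtRel_tukeyLE_seqRel {X : Type*} (U : Filter X) :
    TukeyLE (filtRel U) (seqRel (filtRel U)) :=
  .of_bounded (fun A _ => A) fun _ b hb => ⟨b 0, fun a ha => hb a ha 0⟩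

theorem filtRel_tukeyLE_fubini {X Y : Type*} (U : Filter X) (V : Filter Y) [V.NeBot] :
    TukeyLE (filtRel U) (filtRel (fubini U V)) := by
  refine .of_bounded (fun A => ⟨{p | p.1 ∈ A.1}, ?_⟩) fun S B hB => ?_
  · exact mem_fubini.2 (Filter.mem_of_superset A.2 fun x hx => Filter.univ_mem' fun _ => hx)
  · refine ⟨⟨_, mem_fubini.1 B.2⟩, fun A hA x hx => ?_⟩
    obtain ⟨y, hy⟩ := V.nonempty_of_mem hx
    exact hB A hA hy

open Classical in
/-- The Fubini square of a filter on a countable set is Tukey below its countable power. -/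
theorem fubini_tukeyLE_seqRel {X : Type*} [Countable X] [Nonempty X] (U : Filter X) :
    TukeyLE (filtRel (fubini U U)) (seqRel (filtRel U)) := by
  obtain ⟨q, hq⟩ := exists_surjective_nat X
  refine .of_bounded (fun B n => n.casesOn ⟨_, mem_fubini.1 B.2⟩ fun m =>
    if h : {y | (q m, y) ∈ B.1} ∈ U then ⟨_, h⟩ else ⟨univ, Filter.univ_mem⟩) fun S C hC => ?_
  refine ⟨⟨{p | p.1 ∈ (C 0).1 ∧ p.2 ∈ (C (Function.surjInv hq p.1 + 1)).1}, ?_⟩, ?_⟩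
  · refine mem_fubini.2 (Filter.mem_of_superset (C 0).2 fun x hx => ?_)
    exact Filter.mem_of_superset (C (Function.surjInv hq x + 1)).2 fun y hy => ⟨hx, hy⟩
  · rintro B hB ⟨x, y⟩ ⟨hx, hy⟩
    have hxB : {y | (x, y) ∈ B.1} ∈ U := hC B hB 0 hx
    have key := hC B hB (Function.surjInv hq x + 1) hy
    simp only [Function.surjInv_eq hq x, hxB, dite_true] at key
    exact key

/-- The countable power of an ultrafilter on a countable set is Tukey below its Fubini square. -/
theorem seqRel_tukeyLE_fubini {X : Type*} [Countable X] (U : Ultrafilter X) :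
    TukeyLE (seqRel (filtRel (U : Filter X))) (filtRel (fubini (U : Filter X) (U : Filter X))) := by
  obtain ⟨e, he⟩ := Countable.exists_injective_nat X
  refine .of_bounded (fun A => ⟨{p | ∀ k ≤ e p.1, p.2 ∈ (A k).1}, ?_⟩) fun S B hB => ?_
  · refine mem_fubini.2 (Filter.univ_mem' fun x => ?_)
    refine Filter.mem_of_superset ((Filter.biInter_mem (finite_Iic (e x))).2 fun k _ => (A k).2) ?_
    exact fun y hy => by simpa using hy
  · by_cases hU : ∀ k, {x | k ≤ e x} ∈ U
    · have hx (k : ℕ) : ∃ x, {y | (x, y) ∈ B.1} ∈ (U : Filter X) ∧ k ≤ e x :=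
        U.nonempty_of_mem (Filter.inter_mem (mem_fubini.1 B.2) (hU k))
      choose x hxB hxe using hx
      exact ⟨fun k => ⟨_, hxB k⟩, fun A hA k y hy => hB A hA hy k (hxe k)⟩
    · push Not at hU
      obtain ⟨k, hk⟩ := hU
      have hfin : {x | k ≤ e x}ᶜ.Finite := by
        refine ((finite_Iio k).preimage he.injOn).subset fun x hx => ?_
        simpa using hx
      obtain ⟨a, -, rfl⟩ := Ultrafilter.eq_pure_of_finite_mem hfin
        (Ultrafilter.compl_mem_iff_notMem.2 hk)
      exact ⟨fun _ => ⟨{a}, rfl⟩, fun A _ n => singleton_subset_iff.2 (A n).2⟩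

/-- A countable power of a filter is Tukey below the filter, given pseudo-intersections modulo a
family of dual sets whose countable power is Tukey below the filter. -/
theorem seqRel_tukeyLE_of_hasPIP {X : Type*} {U : Filter X} {I : Set (Set X)}
    (hI : ∀ A ∈ I, Aᶜ ∈ U) (hp : HasPIP U I) (h : TukeyLE (seqRel (subRel I)) (filtRel U)) :
    TukeyLE (seqRel (filtRel U)) (filtRel U) := by
  obtain ⟨f, hf⟩ := h.exists_bounded
  have hB (A : ℕ → {A : Set X // A ∈ U}) := hp (fun n => (A n).1) fun n => (A n).2
  choose B hBU hBI using hB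
  let d (A : ℕ → {A : Set X // A ∈ U}) : ℕ → {A : Set X // A ∈ I} := fun n => ⟨_, hBI A n⟩
  refine .of_bounded (fun A => ⟨B A ∩ (f (d A)).1, Filter.inter_mem (hBU A) (f (d A)).2⟩)
    fun S C hC => ?_
  obtain ⟨D, hD⟩ := hf (d '' S) C (by
    rintro _ ⟨A, hA, rfl⟩
    exact fun x hx => (hC A hA hx).2)
  refine ⟨fun n => ⟨C.1 ∩ (D n).1ᶜ, Filter.inter_mem C.2 (hI _ (D n).2)⟩, ?_⟩
  rintro A hA n x ⟨hxC, hxD⟩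
  by_contra hxA
  exact hxD (hD _ (mem_image_of_mem d hA) n ⟨(hC A hA hxC).1, hxA⟩)

theorem seqRel_compl_tukeyLE {X : Type*} (U : Filter X) :
    TukeyLE (seqRel (subRel {A | Aᶜ ∈ U})) (seqRel (filtRel U)) := by
  refine .of_bounded (fun A n => ⟨_, (A n).2⟩) fun S C hC => ?_
  refine ⟨fun n => ⟨(C n).1ᶜ, ?_⟩, fun A hA n => subset_compl_comm.1 (hC A hA n)⟩
  simpa only [mem_ofPred_eq, compl_compl] using (C n).2

theorem isIdeal_compl {X : Type*} (U : Filter X) : IsIdeal {A | Aᶜ ∈ U} := by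
  refine ⟨by simp, fun A hA B hBA => ?_, fun A hA B hB => ?_⟩
  · exact Filter.mem_of_superset hA (compl_subset_compl.2 hBA)
  · simpa only [mem_ofPred_eq, compl_union] using Filter.inter_mem hA hB

theorem hasPIP_compl {X : Type*} (U : Filter X) : HasPIP U {A | Aᶜ ∈ U} := fun A hA =>
  ⟨univ, Filter.univ_mem, fun n => by simpa [← compl_eq_univ_sdiff] using hA n⟩

/-- For an ultrafilter `U` on a countably infinite set `X`, the
following are equivalent: (1) `U·U ≡_T U`; (2) `∏_{n<ω} U ≡_T U`; (3) there is an
ideal `I ⊆ U*` such that `U` has the `I`-p.i.p. and `∏_{n<ω} I ≤_T U`. -/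
theorem stmt6 {X : Type*} [Countable X] [Infinite X] (U : Ultrafilter X) :
    (TukeyEquiv (filtRel (fubini (U : Filter X) (U : Filter X)))
        (filtRel (U : Filter X)) ↔
      TukeyEquiv (seqRel (filtRel (U : Filter X))) (filtRel (U : Filter X))) ∧
    (TukeyEquiv (filtRel (fubini (U : Filter X) (U : Filter X)))
        (filtRel (U : Filter X)) ↔
      ∃ I : Set (Set X), IsIdeal I ∧ (∀ A ∈ I, Aᶜ ∈ U) ∧
        HasPIP (U : Filter X) I ∧
        TukeyLE (seqRel (subRel I)) (filtRel (U : Filter X))) := by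
  have hle := seqRel_tukeyLE_fubini U
  have hge := fubini_tukeyLE_seqRel (U : Filter X)
  refine ⟨⟨fun h => ⟨hle.trans h.1, filtRel_tukeyLE_seqRel _⟩,
    fun h => ⟨hge.trans h.1, filtRel_tukeyLE_fubini _ _⟩⟩, fun h => ?_, ?_⟩
  · exact ⟨_, isIdeal_compl (U : Filter X), fun _ hA => hA, hasPIP_compl _,
      (seqRel_compl_tukeyLE _).trans (hle.trans h.1)⟩
  · rintro ⟨I, -, hI, hp, h⟩
    exact ⟨hge.trans (seqRel_tukeyLE_of_hasPIP hI hp h), filtRel_tukeyLE_fubini _ _⟩
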